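/- arXiv:2511.08312 — 2 statements merged into one kernel-verified Lean document; each statement's English description precedes it below -/
import Mathlib

section
/- The presented group L₁₅ = ⟨a₁, a₂, b₁, b₂ | a₁², a₂², (a₁a₂)², b₁², b₂², (b₁b₂)², (a₁b₁)², (a₁b₂)², (a₂b₁)², a₂a₁b₂a₂b₂⟩ is isomorphic to the direct product ℤ/2ℤ × D₈, where D₈ denotes the dihedral group of order 8 (the symmetry group of a square); in particular L₁₅ has order 16. -/
/-- The generator `a₁` of the free group on four generators `a₁, a₂, b₁, b₂`. -/
def a₁ : FreeGroup (Fin 4) := FreeGroup.of 0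
/-- The generator `a₂`. -/
def a₂ : FreeGroup (Fin 4) := FreeGroup.of 1
/-- The generator `b₁`. -/
def b₁ : FreeGroup (Fin 4) := FreeGroup.of 2
/-- The generator `b₂`. -/
def b₂ : FreeGroup (Fin 4) := FreeGroup.of 3

/-- The relators of the presentation of `L₁₅`. -/
def rels₁₅ : Set (FreeGroup (Fin 4)) :=
  {a₁ ^ 2, a₂ ^ 2, (a₁ * a₂) ^ 2, b₁ ^ 2, b₂ ^ 2, (b₁ * b₂) ^ 2,
   (a₁ * b₁) ^ 2, (a₁ * b₂) ^ 2, (a₂ * b₁) ^ 2, a₂ * a₁ * b₂ * a₂ * b₂}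

/-- The presented group `L₁₅`. -/
abbrev L₁₅ : Type := PresentedGroup rels₁₅

section Lifts

variable {G : Type*} [Group G] {n : ℕ}

/-- The homomorphism from `ℤ/nℤ` that sends the generator to an element `x` with `x ^ n = 1`. -/
def zmodLift (x : G) (hx : x ^ n = 1) : Multiplicative (ZMod n) →* G :=
  AddMonoidHom.toMultiplicativeLeft
    (ZMod.lift n ⟨zmultiplesHom (Additive G) (Additive.ofMul x), by
      simp [← ofMul_pow, hx]⟩)

theorem zmodLift_intCast (x : G) (hx : x ^ n = 1) (k : ℤ) :
    zmodLift x hx (Multiplicative.ofAdd (k : ZMod n)) = x ^ k := by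
  simp [zmodLift, ← ofMul_zpow]

theorem zmodLift_one (x : G) (hx : x ^ n = 1) :
    zmodLift x hx (Multiplicative.ofAdd (1 : ZMod n)) = x := by
  simpa using zmodLift_intCast x hx 1

theorem zmodLift_mul_comm_of_conj (x s : G) (hx : x ^ n = 1) (hxs : x * s = s * x⁻¹)
    (i : ZMod n) :
    zmodLift x hx (Multiplicative.ofAdd i) * s =
      s * (zmodLift x hx (Multiplicative.ofAdd i))⁻¹ := by
  obtain ⟨k, rfl⟩ := ZMod.intCast_surjective i
  rw [zmodLift_intCast, ← inv_zpow]
  have h : SemiconjBy s x⁻¹ x := hxs.symm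
  exact (h.zpow_right k).eq.symm

theorem zmod_hom_ext {f g : Multiplicative (ZMod n) →* G}
    (h : f (Multiplicative.ofAdd 1) = g (Multiplicative.ofAdd 1)) : f = g := by
  refine MonoidHom.ext fun i => ?_
  obtain ⟨k, hk⟩ := ZMod.intCast_surjective i.toAdd
  have hi : i = Multiplicative.ofAdd (1 : ZMod n) ^ k := by
    rw [← ofAdd_zsmul, zsmul_one, hk, ofAdd_toAdd]
  rw [hi, map_zpow, map_zpow, h]

/-- The homomorphism from the dihedral group that sends the rotation `r 1` to `x` and the
reflection `sr 0` to `s`. -/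
def dihedralLift (x s : G) (hx : x ^ n = 1) (hs : s * s = 1) (hxs : x * s = s * x⁻¹) :
    DihedralGroup n →* G :=
  MonoidHom.mk'
    (fun d => match d with
      | .r i => zmodLift x hx (Multiplicative.ofAdd i)
      | .sr i => s * zmodLift x hx (Multiplicative.ofAdd i)) (by
    have hc := zmodLift_mul_comm_of_conj x s hx hxs
    rintro (i | i) (j | j)
    · simp
    · simp only [DihedralGroup.r_mul_sr]
      rw [← mul_assoc, hc, sub_eq_neg_add, ofAdd_add, ofAdd_neg, map_mul, map_inv, mul_assoc]
    · simp [mul_assoc]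
    · simp only [DihedralGroup.sr_mul_sr]
      rw [mul_assoc, ← mul_assoc _ s, hc, ← mul_assoc, ← mul_assoc, hs, one_mul,
        sub_eq_neg_add, ofAdd_add, ofAdd_neg, map_mul, map_inv])

theorem dihedralLift_r (x s : G) (hx : x ^ n = 1) (hs : s * s = 1) (hxs : x * s = s * x⁻¹)
    (i : ZMod n) :
    dihedralLift x s hx hs hxs (.r i) = zmodLift x hx (Multiplicative.ofAdd i) := rfl

theorem dihedralLift_sr (x s : G) (hx : x ^ n = 1) (hs : s * s = 1) (hxs : x * s = s * x⁻¹)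
    (i : ZMod n) :
    dihedralLift x s hx hs hxs (.sr i) = s * zmodLift x hx (Multiplicative.ofAdd i) := rfl

theorem dihedralLift_r_one (x s : G) (hx : x ^ n = 1) (hs : s * s = 1)
    (hxs : x * s = s * x⁻¹) : dihedralLift x s hx hs hxs (.r 1) = x := by
  rw [dihedralLift_r, zmodLift_one]

theorem dihedralLift_sr_zero (x s : G) (hx : x ^ n = 1) (hs : s * s = 1)
    (hxs : x * s = s * x⁻¹) : dihedralLift x s hx hs hxs (.sr 0) = s := by
  simp [dihedralLift_sr]

theorem dihedral_hom_ext {f g : DihedralGroup n →* G} (hr : f (.r 1) = g (.r 1))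
    (hs : f (.sr 0) = g (.sr 0)) : f = g := by
  have h (i : ZMod n) : f (.r i) = g (.r i) := by
    obtain ⟨k, rfl⟩ := ZMod.intCast_surjective i
    rw [← DihedralGroup.r_one_zpow, map_zpow, map_zpow, hr]
  ext (i | i)
  · exact h i
  · rw [show DihedralGroup.sr i = .sr 0 * .r i by simp, map_mul, map_mul, hs, h]

theorem commute_dihedralLift (x s : G) (hx : x ^ n = 1) (hs : s * s = 1)
    (hxs : x * s = s * x⁻¹) {z : G} (hzx : Commute z x) (hzs : Commute z s)
    (d : DihedralGroup n) : Commute z (dihedralLift x s hx hs hxs d) := by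
  have h (i : ZMod n) : Commute z (zmodLift x hx (Multiplicative.ofAdd i)) := by
    obtain ⟨k, rfl⟩ := ZMod.intCast_surjective i
    rw [zmodLift_intCast]
    exact hzx.zpow_right k
  rcases d with i | i
  · exact h i
  · exact hzs.mul_right (h i)

theorem commute_of_sq_eq_one {a b : G} (ha : a ^ 2 = 1) (hb : b ^ 2 = 1)
    (hab : (a * b) ^ 2 = 1) : Commute a b := by
  rw [sq, mul_eq_one_iff_eq_inv] at ha hb hab
  rw [mul_inv_rev, ← ha, ← hb] at hab
  exact hab

end Lifts

namespace L₁₅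

/-- The images of `a₁, a₂, b₁, b₂` in `ℤ/2ℤ × D₈`. -/
def genImage : Fin 4 → Multiplicative (ZMod 2) × DihedralGroup 4 :=
  ![(1, .r 2), (1, .sr 0), (Multiplicative.ofAdd 1, 1), (1, .sr 1)]

theorem lift_genImage_eq_one : ∀ w ∈ rels₁₅, FreeGroup.lift genImage w = 1 := by
  simp only [rels₁₅, Set.mem_insert_iff, Set.mem_singleton_iff, forall_eq_or_imp, forall_eq,
    a₁, a₂, b₁, b₂, map_mul, map_pow, FreeGroup.lift_apply_of]
  decide

/-- The homomorphism `L₁₅ → ℤ/2ℤ × D₈` given by `genImage`. -/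
def toProd : L₁₅ →* Multiplicative (ZMod 2) × DihedralGroup 4 :=
  PresentedGroup.toGroup lift_genImage_eq_one

/-- The generators of `L₁₅`. -/
def gen (i : Fin 4) : L₁₅ := PresentedGroup.of i

theorem toProd_gen (i : Fin 4) : toProd (gen i) = genImage i :=
  PresentedGroup.toGroup.of lift_genImage_eq_one

theorem mk_eq_one {w : FreeGroup (Fin 4)} (hw : w ∈ rels₁₅) :
    PresentedGroup.mk rels₁₅ w = 1 :=
  (QuotientGroup.eq_one_iff w).2 (Subgroup.subset_normalClosure hw)

theorem gen_sq (i : Fin 4) : gen i ^ 2 = 1 := by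
  fin_cases i
  · exact mk_eq_one (w := a₁ ^ 2) (by simp [rels₁₅])
  · exact mk_eq_one (w := a₂ ^ 2) (by simp [rels₁₅])
  · exact mk_eq_one (w := b₁ ^ 2) (by simp [rels₁₅])
  · exact mk_eq_one (w := b₂ ^ 2) (by simp [rels₁₅])

theorem gen_mul_self (i : Fin 4) : gen i * gen i = 1 := by
  rw [← sq, gen_sq]

theorem commute_a₁_a₂ : Commute (gen 0) (gen 1) :=
  commute_of_sq_eq_one (gen_sq 0) (gen_sq 1)
    (mk_eq_one (w := (a₁ * a₂) ^ 2) (by simp [rels₁₅]))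

theorem commute_b₁_b₂ : Commute (gen 2) (gen 3) :=
  commute_of_sq_eq_one (gen_sq 2) (gen_sq 3)
    (mk_eq_one (w := (b₁ * b₂) ^ 2) (by simp [rels₁₅]))

theorem commute_a₂_b₁ : Commute (gen 1) (gen 2) :=
  commute_of_sq_eq_one (gen_sq 1) (gen_sq 2)
    (mk_eq_one (w := (a₂ * b₁) ^ 2) (by simp [rels₁₅]))

theorem a₂_mul_b₂_sq : (gen 1 * gen 3) ^ 2 = gen 0 := by
  have h : gen 1 * gen 0 * gen 3 * gen 1 * gen 3 = 1 :=
    mk_eq_one (w := a₂ * a₁ * b₂ * a₂ * b₂) (by simp [rels₁₅])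
  rw [← commute_a₁_a₂.eq] at h
  have h' : gen 0 * (gen 1 * gen 3) ^ 2 = 1 := by
    rw [← h, sq]
    simp only [mul_assoc]
  exact (mul_eq_one_iff_inv_eq.1 h').symm.trans
    (inv_eq_of_mul_eq_one_left (gen_mul_self 0))

theorem a₂_mul_b₂_pow_four : (gen 1 * gen 3) ^ 4 = 1 := by
  refine (pow_mul _ 2 2).trans ?_
  rw [a₂_mul_b₂_sq, gen_sq]

theorem a₂_mul_b₂_mul_a₂ : gen 1 * gen 3 * gen 1 = gen 1 * (gen 1 * gen 3)⁻¹ := by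
  rw [mul_inv_rev, inv_eq_of_mul_eq_one_left (gen_mul_self 1),
    inv_eq_of_mul_eq_one_left (gen_mul_self 3), mul_assoc]

/-- The homomorphism `D₈ → L₁₅` that sends `r 1` to `a₂ b₂` and `sr 0` to `a₂`. -/
def ofDihedral : DihedralGroup 4 →* L₁₅ :=
  dihedralLift (gen 1 * gen 3) (gen 1) a₂_mul_b₂_pow_four (gen_mul_self 1) a₂_mul_b₂_mul_a₂

theorem ofDihedral_r_one : ofDihedral (.r 1) = gen 1 * gen 3 :=
  dihedralLift_r_one ..

theorem ofDihedral_sr_zero : ofDihedral (.sr 0) = gen 1 :=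
  dihedralLift_sr_zero ..

/-- The homomorphism `ℤ/2ℤ × D₈ → L₁₅` that is `ofDihedral` on `D₈` and sends the generator of
`ℤ/2ℤ` to `b₁`. -/
def ofProd : Multiplicative (ZMod 2) × DihedralGroup 4 →* L₁₅ :=
  (zmodLift (gen 2) (gen_sq 2)).noncommCoprod ofDihedral fun i d => by
    have h : Commute (gen 2) (ofDihedral d) :=
      commute_dihedralLift _ _ _ _ _ (commute_a₂_b₁.symm.mul_right commute_b₁_b₂)
        commute_a₂_b₁.symm d
    obtain ⟨k, hk⟩ := ZMod.intCast_surjective i.toAdd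
    rw [← ofAdd_toAdd i, ← hk, zmodLift_intCast]
    exact h.zpow_left k

theorem ofProd_comp_toProd : ofProd.comp toProd = MonoidHom.id L₁₅ := by
  refine PresentedGroup.ext fun i => ?_
  change ofProd (toProd (gen i)) = gen i
  rw [toProd_gen]
  fin_cases i
  · change zmodLift (gen 2) (gen_sq 2) 1 * ofDihedral (.r 2) = gen 0
    rw [map_one, one_mul, show DihedralGroup.r (2 : ZMod 4) = .r 1 ^ 2 by decide, map_pow,
      ofDihedral_r_one, a₂_mul_b₂_sq]
  · change zmodLift (gen 2) (gen_sq 2) 1 * ofDihedral (.sr 0) = gen 1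
    rw [map_one, one_mul, ofDihedral_sr_zero]
  · change zmodLift (gen 2) (gen_sq 2) (Multiplicative.ofAdd 1) * ofDihedral 1 = gen 2
    rw [map_one ofDihedral, mul_one, zmodLift_one]
  · change zmodLift (gen 2) (gen_sq 2) 1 * ofDihedral (.sr 1) = gen 3
    rw [map_one, one_mul, show DihedralGroup.sr (1 : ZMod 4) = .sr 0 * .r 1 by decide, map_mul,
      ofDihedral_r_one, ofDihedral_sr_zero, ← mul_assoc, gen_mul_self, one_mul]

theorem toProd_comp_ofProd : toProd.comp ofProd = MonoidHom.id _ := by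
  have hz : (toProd.comp ofProd).comp (MonoidHom.inl _ _) = MonoidHom.inl _ _ := by
    apply zmod_hom_ext
    change toProd (zmodLift (gen 2) (gen_sq 2) (Multiplicative.ofAdd 1) * ofDihedral 1) = _
    rw [map_one ofDihedral, mul_one, zmodLift_one, toProd_gen]
    rfl
  have hd : (toProd.comp ofProd).comp (MonoidHom.inr _ _) = MonoidHom.inr _ _ := by
    apply dihedral_hom_ext
    · change toProd (zmodLift (gen 2) (gen_sq 2) 1 * ofDihedral (.r 1)) = _
      rw [map_one, one_mul, ofDihedral_r_one, map_mul, toProd_gen, toProd_gen]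
      decide
    · change toProd (zmodLift (gen 2) (gen_sq 2) 1 * ofDihedral (.sr 0)) = _
      rw [map_one, one_mul, ofDihedral_sr_zero, toProd_gen]
      rfl
  refine MonoidHom.ext fun p => ?_
  have hp : p = MonoidHom.inl _ _ p.1 * MonoidHom.inr _ _ p.2 := by simp
  rw [hp, map_mul, map_mul]
  exact congrArg₂ (· * ·) (DFunLike.congr_fun hz p.1) (DFunLike.congr_fun hd p.2)

/-- The isomorphism `L₁₅ ≃ ℤ/2ℤ × D₈`. -/
def mulEquivProd : L₁₅ ≃* Multiplicative (ZMod 2) × DihedralGroup 4 :=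
  toProd.toMulEquiv ofProd ofProd_comp_toProd toProd_comp_ofProd

end L₁₅

/-- The presented group `L₁₅` is isomorphic to `ℤ/2ℤ × D₈`, where `D₈` is the dihedral
group of order 8; in particular `L₁₅` has order 16. -/
theorem stmt_17 :
    Nonempty (L₁₅ ≃* (Multiplicative (ZMod 2) × DihedralGroup 4)) ∧
    Nat.card L₁₅ = 16 := by
  refine ⟨⟨L₁₅.mulEquivProd⟩, ?_⟩
  rw [Nat.card_congr L₁₅.mulEquivProd.toEquiv, Nat.card_prod, DihedralGroup.nat_card,
    Nat.card_congr Multiplicative.toAdd, Nat.card_zmod]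
end

section
/- The presented group L₂₂ = ⟨a, b | a⁶, b⁶, (ab)², (ab⁻¹)²⟩ is isomorphic to the direct product Sym(3) × Sym(3) of two copies of the symmetric group on 3 letters; in particular L₂₂ has order 36. -/
/-- The generator `a` of the free group on two generators `a, b`. -/
def a : FreeGroup (Fin 2) := FreeGroup.of 0
/-- The generator `b`. -/
def b : FreeGroup (Fin 2) := FreeGroup.of 1

/-- The relators of the presentation of `L₂₂`. -/
def rels₂₂ : Set (FreeGroup (Fin 2)) :=
  {a ^ 6, b ^ 6, (a * b) ^ 2, (a * b⁻¹) ^ 2}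

/-- The presented group `L₂₂`. -/
abbrev L₂₂ : Type := PresentedGroup rels₂₂

section Factorization

variable {G : Type*} [Group G] {x y : G}

theorem mul_eq_inv_mul_inv_of_mul_sq_eq_one (h : (x * y) ^ 2 = 1) : y * x = x⁻¹ * y⁻¹ := by
  rw [pow_two, mul_assoc, mul_eq_one_iff_eq_inv', ← mul_assoc] at h
  exact eq_mul_inv_of_mul_eq h

theorem semiconjBy_sq_inv_of_mul_sq_eq_one (h₁ : (x * y) ^ 2 = 1) (h₂ : (x * y⁻¹) ^ 2 = 1) :
    SemiconjBy y (x ^ 2) (x ^ 2)⁻¹ := by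
  have h := mul_eq_inv_mul_inv_of_mul_sq_eq_one h₂
  rw [inv_inv] at h
  rw [SemiconjBy, pow_two, mul_inv_rev, ← mul_assoc, mul_eq_inv_mul_inv_of_mul_sq_eq_one h₁,
    mul_assoc, h, mul_assoc]

/-- If `(x * y) ^ 2 = (x * y⁻¹) ^ 2 = 1`, then `y` can be moved past powers of `x`. -/
theorem exists_mul_zpow_eq_zpow_mul_zpow (h₁ : (x * y) ^ 2 = 1) (h₂ : (x * y⁻¹) ^ 2 = 1)
    (i : ℤ) : ∃ e : ℤ, y * x ^ i = x ^ (-i) * y ^ e := by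
  have hs (m : ℤ) : y * x ^ (2 * m) = x ^ (-(2 * m)) * y := by
    have := (semiconjBy_sq_inv_of_mul_sq_eq_one h₁ h₂).zpow_right m
    simpa only [SemiconjBy, inv_zpow, ← zpow_natCast, ← zpow_mul, ← zpow_neg, Nat.cast_ofNat,
      mul_neg, neg_mul] using this
  obtain ⟨m, rfl | rfl⟩ := i.even_or_odd'
  · exact ⟨1, by rw [hs, zpow_one]⟩
  · refine ⟨-1, ?_⟩
    rw [zpow_add, zpow_one, ← mul_assoc, hs, mul_assoc,
      mul_eq_inv_mul_inv_of_mul_sq_eq_one h₁]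
    group

/-- If `x, y` generate `G` and `(x * y) ^ 2 = (x * y⁻¹) ^ 2 = 1`, then `G` is the product set of
the cyclic subgroups generated by `x` and `y`. -/
theorem exists_eq_zpow_mul_zpow (hG : Subgroup.closure {x, y} = ⊤)
    (h₁ : (x * y) ^ 2 = 1) (h₂ : (x * y⁻¹) ^ 2 = 1) (g : G) :
    ∃ i j : ℤ, g = x ^ i * y ^ j := by
  have hg : g ∈ Subgroup.closure {x, y} := hG ▸ Subgroup.mem_top g
  induction hg using Subgroup.closure_induction_left with
  | one => exact ⟨0, 0, by simp⟩
  | mul_left z hz w _ ih =>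
    obtain ⟨i, j, rfl⟩ := ih
    obtain rfl | rfl := hz
    · exact ⟨1 + i, j, by rw [zpow_add, zpow_one, mul_assoc]⟩
    · obtain ⟨e, he⟩ := exists_mul_zpow_eq_zpow_mul_zpow h₁ h₂ i
      exact ⟨-i, e + j, by rw [← mul_assoc, he, mul_assoc, zpow_add]⟩
  | inv_mul_cancel z hz w _ ih =>
    obtain ⟨i, j, rfl⟩ := ih
    obtain rfl | rfl := hz
    · exact ⟨-1 + i, j, by rw [zpow_add, zpow_neg_one, mul_assoc]⟩
    · obtain ⟨e, he⟩ := exists_mul_zpow_eq_zpow_mul_zpow h₂ (by rwa [inv_inv]) i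
      exact ⟨-i, -e + j, by rw [← mul_assoc, he, mul_assoc, zpow_add, inv_zpow, zpow_neg _ e]⟩

theorem exists_pow_fin_eq_zpow {n : ℕ} [NeZero n] (hx : x ^ n = 1) (i : ℤ) :
    ∃ k : Fin n, x ^ (k : ℕ) = x ^ i := by
  have hn : (0 : ℤ) < n := by exact_mod_cast Nat.pos_of_neZero n
  have h0 := Int.emod_nonneg i hn.ne'
  have h1 := Int.emod_lt_of_pos i hn
  refine ⟨⟨(i % n).toNat, by omega⟩, ?_⟩
  rw [← zpow_natCast, Int.toNat_of_nonneg h0, ← zpow_eq_zpow_emod' i hx]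

end Factorization

namespace L₂₂

/-- The images in `Sym(3) × Sym(3)` of the two generators. -/
def permPair : Fin 2 → Equiv.Perm (Fin 3) × Equiv.Perm (Fin 3) :=
  ![(finRotate 3, Equiv.swap 0 1), (Equiv.swap 0 1, finRotate 3)]

theorem lift_permPair_eq_one : ∀ r ∈ rels₂₂, FreeGroup.lift permPair r = 1 := by
  rintro r (rfl | rfl | rfl | rfl) <;>
    simp only [a, b, map_pow, map_mul, map_inv, FreeGroup.lift_apply_of] <;> decide

/-- The homomorphism `L₂₂ → Sym(3) × Sym(3)` sending the generators to `permPair`. -/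
def toPermProd : L₂₂ →* Equiv.Perm (Fin 3) × Equiv.Perm (Fin 3) :=
  PresentedGroup.toGroup lift_permPair_eq_one

theorem closure_generators :
    Subgroup.closure {PresentedGroup.mk rels₂₂ a, PresentedGroup.mk rels₂₂ b} = ⊤ := by
  rw [← PresentedGroup.closure_range_of rels₂₂]
  congr 1
  ext g
  simp [PresentedGroup.of, a, b, Fin.exists_fin_two, eq_comm]

/-- The product `a ^ i * b ^ j` in `L₂₂`. -/
def normalForm (p : Fin 6 × Fin 6) : L₂₂ :=
  PresentedGroup.mk rels₂₂ a ^ (p.1 : ℕ) * PresentedGroup.mk rels₂₂ b ^ (p.2 : ℕ)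

theorem normalForm_surjective : Function.Surjective normalForm := by
  intro g
  have ha : PresentedGroup.mk rels₂₂ a ^ 6 = 1 := by
    rw [← map_pow]; exact PresentedGroup.one_of_mem (by simp [rels₂₂])
  have hb : PresentedGroup.mk rels₂₂ b ^ 6 = 1 := by
    rw [← map_pow]; exact PresentedGroup.one_of_mem (by simp [rels₂₂])
  obtain ⟨i, j, rfl⟩ := exists_eq_zpow_mul_zpow closure_generators
    (by rw [← map_mul, ← map_pow]; exact PresentedGroup.one_of_mem (by simp [rels₂₂]))
    (by rw [← map_inv, ← map_mul, ← map_pow]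
        exact PresentedGroup.one_of_mem (by simp [rels₂₂])) g
  obtain ⟨k, hk⟩ := exists_pow_fin_eq_zpow ha i
  obtain ⟨l, hl⟩ := exists_pow_fin_eq_zpow hb j
  exact ⟨(k, l), by rw [normalForm, hk, hl]⟩

theorem toPermProd_normalForm (p : Fin 6 × Fin 6) :
    toPermProd (normalForm p) = permPair 0 ^ (p.1 : ℕ) * permPair 1 ^ (p.2 : ℕ) := by
  have h (i : Fin 2) : toPermProd (PresentedGroup.mk rels₂₂ (FreeGroup.of i)) = permPair i :=
    PresentedGroup.toGroup.of lift_permPair_eq_one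
  simp only [normalForm, map_mul, map_pow, a, b, h]

theorem toPermProd_normalForm_bijective : Function.Bijective (toPermProd ∘ normalForm) := by
  rw [Fintype.bijective_iff_injective_and_card]
  refine ⟨?_, by simp [Fintype.card_perm, Nat.factorial]⟩
  have h : Function.Injective fun p : Fin 6 × Fin 6 ↦
      permPair 0 ^ (p.1 : ℕ) * permPair 1 ^ (p.2 : ℕ) := by
    decide
  simpa only [Function.comp_def, toPermProd_normalForm] using h

theorem toPermProd_bijective : Function.Bijective toPermProd :=
  ⟨toPermProd_normalForm_bijective.injective.of_comp_right normalForm_surjective,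
    toPermProd_normalForm_bijective.surjective.of_comp⟩

end L₂₂

/-- The presented group `L₂₂ = ⟨a, b ∣ a⁶, b⁶, (ab)², (ab⁻¹)²⟩` is isomorphic to
`Sym(3) × Sym(3)`; in particular it has order 36. -/
theorem stmt_18 :
    Nonempty (L₂₂ ≃* (Equiv.Perm (Fin 3) × Equiv.Perm (Fin 3))) ∧
    Nat.card L₂₂ = 36 := by
  have e := MulEquiv.ofBijective L₂₂.toPermProd L₂₂.toPermProd_bijective
  refine ⟨⟨e⟩, ?_⟩
  rw [Nat.card_congr e.toEquiv, Nat.card_prod, Nat.card_perm, Nat.card_fin]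
  rfl
end
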